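/- Let I ⊆ ℝ be an open interval and F₁, g : I → ℝ be C^∞. On the open region of J^∞(ℝ,ℝ²) where y^1_1 ≠ 0 and z := y^1_2 / y^1_1 ∈ I, define principal components ξ = g(z), η^0_1 = F₁′(z), η^0_2 = z F₁′(z) − F₁(z) (depending only on y^1_1 and y^1_2). Then the Lie–Bäcklund field on J^∞(ℝ,ℝ²) with these principal components is exponentiable to a local flow Φ_t = (Ξ_t, H^α_{L,t}) whose first components satisfy Ξ_t = x + t ξ(y^1_1,y^1_2) and H^0_{L,t} = y^0_L + t η^0_L(y^1_1,y^1_2) for L = 1,2 (so Ξ_t and H^0_{L,t} do not depend on any coordinate y^γ_M with γ ≥ 2). -/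

import Mathlib

open scoped BigOperators

/-- The infinite jet space `J^∞(ℝ, ℝ²)`: coordinates `x` and `y^k_L`
(`L ∈ Fin 2`, `k ∈ ℕ`). -/
abbrev JetB := ℝ × (Fin 2 × ℕ → ℝ)

/-- Partial derivative with respect to the coordinate `x`. -/
noncomputable def pdX (F : JetB → ℝ) : JetB → ℝ :=
  fun p => deriv (fun t => F (t, p.2)) p.1

/-- Partial derivative with respect to the coordinate `y^k_L`, `q = (L, k)`. -/
noncomputable def pdY (q : Fin 2 × ℕ) (F : JetB → ℝ) : JetB → ℝ :=
  fun p => deriv (fun t => F (p.1, Function.update p.2 q t)) (p.2 q)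

/-- A function on `J^∞(ℝ,ℝ²)` is admissible if it is a `C^∞` function of finitely
many of the coordinates. -/
def Admissible (F : JetB → ℝ) : Prop :=
  ∃ (S : Finset (Fin 2 × ℕ)) (g : ℝ × (↥S → ℝ) → ℝ),
    ContDiff ℝ (⊤ : ℕ∞) g ∧ ∀ p : JetB, F p = g (p.1, fun a => p.2 a.1)

/-- The total derivative `D = ∂/∂x + Σ_{L,k} y^{k+1}_L ∂/∂y^k_L`. -/
noncomputable def totD (F : JetB → ℝ) : JetB → ℝ :=
  fun p => pdX F p + ∑ᶠ q : Fin 2 × ℕ, p.2 (q.1, q.2 + 1) * pdY q F p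

/-- The components `η^k_L` of the Lie–Bäcklund field with principal components
`ξ, η^0_1, η^0_2`, determined by the recursion `η^{k+1}_L = D η^k_L − y^{k+1}_L D ξ`. -/
noncomputable def etaLB (ξ : JetB → ℝ) (η0 : Fin 2 → JetB → ℝ) (L : Fin 2) :
    ℕ → JetB → ℝ
  | 0 => η0 L
  | (k + 1) => fun p => totD (etaLB ξ η0 L k) p - p.2 (L, k + 1) * totD ξ p

/-- `F` depends only on the coordinates `(x, y^0_1, y^0_2, y^1_1, y^1_2)`. -/
def LowOrder (F : JetB → ℝ) : Prop :=
  ∀ p q : JetB, p.1 = q.1 →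
    (∀ (L : Fin 2) (k : ℕ), k ≤ 1 → p.2 (L, k) = q.2 (L, k)) → F p = F q

/-- `O_L = ∂η^0_L/∂x − y^1_L ∂ξ/∂x`. -/
noncomputable def Ocomp (ξ : JetB → ℝ) (η0 : Fin 2 → JetB → ℝ) (L : Fin 2) :
    JetB → ℝ :=
  fun p => pdX (η0 L) p - p.2 (L, 1) * pdX ξ p

/-- `N^Q_L = ∂η^0_L/∂y^0_Q − y^1_L ∂ξ/∂y^0_Q`. -/
noncomputable def Ncomp (ξ : JetB → ℝ) (η0 : Fin 2 → JetB → ℝ) (Q L : Fin 2) :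
    JetB → ℝ :=
  fun p => pdY (Q, 0) (η0 L) p - p.2 (L, 1) * pdY (Q, 0) ξ p

/-- `M^Q_L = ∂η^0_L/∂y^1_Q − y^1_L ∂ξ/∂y^1_Q`. -/
noncomputable def Mcomp (ξ : JetB → ℝ) (η0 : Fin 2 → JetB → ℝ) (Q L : Fin 2) :
    JetB → ℝ :=
  fun p => pdY (Q, 1) (η0 L) p - p.2 (L, 1) * pdY (Q, 1) ξ p

/-- `Q^R_M = ξ ∂M^R_M/∂x + Σ_K η^0_K ∂M^R_M/∂y^0_K
+ Σ_K (O_K + Σ_Q y^1_Q N^Q_K) ∂M^R_M/∂y^1_K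
− (Σ_N M^R_N ∂O_M/∂y^1_N + Σ_Q M^R_Q N^Q_M + Σ_{N,Q} M^R_N y^1_Q ∂N^Q_M/∂y^1_N)`. -/
noncomputable def Qcomp (ξ : JetB → ℝ) (η0 : Fin 2 → JetB → ℝ) (R M : Fin 2) :
    JetB → ℝ :=
  fun p =>
    ξ p * pdX (Mcomp ξ η0 R M) p
      + (∑ K, η0 K p * pdY (K, 0) (Mcomp ξ η0 R M) p)
      + (∑ K, (Ocomp ξ η0 K p + ∑ Q, p.2 (Q, 1) * Ncomp ξ η0 Q K p) *
          pdY (K, 1) (Mcomp ξ η0 R M) p)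
      - ((∑ N, Mcomp ξ η0 R N p * pdY (N, 1) (Ocomp ξ η0 M) p)
          + (∑ Q, Mcomp ξ η0 R Q p * Ncomp ξ η0 Q M p)
          + (∑ N, ∑ Q, Mcomp ξ η0 R N p * p.2 (Q, 1) * pdY (N, 1) (Ncomp ξ η0 Q M) p))

/-- `F t` is, for `t ∈ I` and on `W`, a `C^∞` function of `t` and finitely many
coordinates, the finite set of relevant coordinates being independent of `t`. -/
def AdmissibleTOn (I : Set ℝ) (W : Set JetB) (F : ℝ → JetB → ℝ) : Prop :=
  ∃ (S : Finset (Fin 2 × ℕ)) (U : Set (ℝ × ℝ × (↥S → ℝ)))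
    (g : ℝ × ℝ × (↥S → ℝ) → ℝ),
    IsOpen U ∧ ContDiffOn ℝ (⊤ : ℕ∞) g U ∧
    ∀ t ∈ I, ∀ p ∈ W, (t, p.1, fun a => p.2 a.1) ∈ U ∧
      F t p = g (t, p.1, fun a => p.2 a.1)

/-- `Φ` is a local flow (for times in `(-δ,δ)`, on the set `W`) exponentiating the
Lie–Bäcklund field with principal components `ξ, η0` on `J^∞(ℝ,ℝ²)`. -/
def IsLocalFlowOf (ξ : JetB → ℝ) (η0 : Fin 2 → JetB → ℝ) (W : Set JetB) (δ : ℝ)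
    (Φ : ℝ → JetB → JetB) : Prop :=
  AdmissibleTOn (Set.Ioo (-δ) δ) W (fun t p => (Φ t p).1) ∧
  (∀ q : Fin 2 × ℕ, AdmissibleTOn (Set.Ioo (-δ) δ) W fun t p => (Φ t p).2 q) ∧
  (∀ p ∈ W, Φ 0 p = p) ∧
  (∀ s ∈ Set.Ioo (-δ) δ, ∀ t ∈ Set.Ioo (-δ) δ, t + s ∈ Set.Ioo (-δ) δ →
    ∀ p ∈ W, Φ s p ∈ W → Φ t (Φ s p) = Φ (t + s) p) ∧
  (∀ p ∈ W, HasDerivAt (fun t => (Φ t p).1) (ξ p) 0) ∧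
  (∀ (L : Fin 2) (k : ℕ), ∀ p ∈ W,
    HasDerivAt (fun t => (Φ t p).2 (L, k)) (etaLB ξ η0 L k p) 0)

/-- `F` depends, on `W`, only on the coordinates `(x, y^0_1, y^0_2, y^1_1, y^1_2)`. -/
def LowOrderOn (W : Set JetB) (F : JetB → ℝ) : Prop :=
  ∀ p ∈ W, ∀ q ∈ W, p.1 = q.1 →
    (∀ (L : Fin 2) (k : ℕ), k ≤ 1 → p.2 (L, k) = q.2 (L, k)) → F p = F q

/-- Projection of `J^∞(ℝ,ℝ²)` onto the first-order coordinates
`(x, (y^0_1, y^0_2), (y^1_1, y^1_2))`. -/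
def proj1 (p : JetB) : ℝ × (Fin 2 → ℝ) × (Fin 2 → ℝ) :=
  (p.1, fun L => p.2 (L, 0), fun L => p.2 (L, 1))

open Filter Topology

/-- Extension by zero of finitely many jet coordinates (together with time) to a point of
`ℝ × J^∞(ℝ,ℝ²)`. -/
def extendZero (S : Finset (Fin 2 × ℕ)) (e : ℝ × ℝ × (↥S → ℝ)) : ℝ × JetB :=
  (e.1, e.2.1, fun q => if h : q ∈ S then e.2.2 ⟨q, h⟩ else 0)

/-- Restriction of a point of `ℝ × J^∞(ℝ,ℝ²)` to finitely many jet coordinates. -/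
def restrictTo (S : Finset (Fin 2 × ℕ)) (p : ℝ × JetB) : ℝ × ℝ × (↥S → ℝ) :=
  (p.1, p.2.1, fun a => p.2.2 a.1)

/-- An open set described by finitely many coordinates. -/
structure FinitaryOpen (O : Set (ℝ × JetB)) : Prop where
  isOpen : IsOpen O
  eventually_mem : ∀ᶠ S in atTop, ∀ p ∈ O, extendZero S (restrictTo S p) ∈ O

/-- `F` is, on `O`, a `C^∞` function of time and finitely many coordinates. -/
def FinSmooth (O : Set (ℝ × JetB)) (F : ℝ × JetB → ℝ) : Prop :=
  ∀ᶠ S in atTop, ContDiffOn ℝ (⊤ : ℕ∞) (fun e => F (extendZero S e)) (extendZero S ⁻¹' O) ∧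
    ∀ p ∈ O, F p = F (extendZero S (restrictTo S p))

theorem continuous_extendZero (S : Finset (Fin 2 × ℕ)) : Continuous (extendZero S) := by
  unfold extendZero
  refine continuous_fst.prodMk ((continuous_fst.comp continuous_snd).prodMk ?_)
  refine continuous_pi fun q => ?_
  by_cases h : q ∈ S
  · simp only [h, dif_pos]; fun_prop
  · simp only [h, dif_neg, not_false_eq_true]; fun_prop

theorem continuous_restrictTo (S : Finset (Fin 2 × ℕ)) : Continuous (restrictTo S) := by
  unfold restrictTo; fun_prop

theorem restrictTo_extendZero_restrictTo {S S' : Finset (Fin 2 × ℕ)} (h : S ⊆ S')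
    (p : ℝ × JetB) : restrictTo S (extendZero S' (restrictTo S' p)) = restrictTo S p := by
  unfold restrictTo extendZero
  refine Prod.ext rfl (Prod.ext rfl (funext fun a => ?_))
  simp [h a.2]

theorem contDiff_extendZero_apply (S : Finset (Fin 2 × ℕ)) (q : Fin 2 × ℕ) :
    ContDiff ℝ (⊤ : ℕ∞) (fun e => (extendZero S e).2.2 q) := by
  unfold extendZero
  by_cases h : q ∈ S
  · simp only [h, dif_pos]; fun_prop
  · simp only [h, dif_neg, not_false_eq_true]; fun_prop

theorem finitaryOpen_univ : FinitaryOpen Set.univ :=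
  ⟨isOpen_univ, Eventually.of_forall fun _ _ _ => trivial⟩

theorem finSmooth_coord (O : Set (ℝ × JetB)) (q : Fin 2 × ℕ) :
    FinSmooth O (fun p => p.2.2 q) := by
  filter_upwards [eventually_ge_atTop {q}] with S hS
  refine ⟨(contDiff_extendZero_apply S q).contDiffOn, fun p _ => ?_⟩
  have : q ∈ S := hS (by simp)
  simp [extendZero, restrictTo, this]

theorem finSmooth_time (O : Set (ℝ × JetB)) : FinSmooth O (fun p => p.1) :=
  Eventually.of_forall fun _ => ⟨contDiff_fst.contDiffOn, fun _ _ => rfl⟩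

theorem finSmooth_base (O : Set (ℝ × JetB)) : FinSmooth O (fun p => p.2.1) :=
  Eventually.of_forall fun _ => ⟨contDiff_snd.fst.contDiffOn, fun _ _ => rfl⟩

theorem finSmooth_const (O : Set (ℝ × JetB)) (c : ℝ) : FinSmooth O (fun _ => c) :=
  Eventually.of_forall fun _ => ⟨contDiffOn_const, fun _ _ => rfl⟩

namespace FinSmooth

variable {O : Set (ℝ × JetB)} {F G : ℝ × JetB → ℝ}

theorem add (hF : FinSmooth O F) (hG : FinSmooth O G) : FinSmooth O (fun p => F p + G p) := by
  filter_upwards [hF, hG] with S h1 h2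
  exact ⟨h1.1.add h2.1, fun p hp => congrArg₂ (· + ·) (h1.2 p hp) (h2.2 p hp)⟩

theorem sub (hF : FinSmooth O F) (hG : FinSmooth O G) : FinSmooth O (fun p => F p - G p) := by
  filter_upwards [hF, hG] with S h1 h2
  exact ⟨h1.1.sub h2.1, fun p hp => congrArg₂ (· - ·) (h1.2 p hp) (h2.2 p hp)⟩

theorem mul (hF : FinSmooth O F) (hG : FinSmooth O G) : FinSmooth O (fun p => F p * G p) := by
  filter_upwards [hF, hG] with S h1 h2
  exact ⟨h1.1.mul h2.1, fun p hp => congrArg₂ (· * ·) (h1.2 p hp) (h2.2 p hp)⟩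

theorem div (hF : FinSmooth O F) (hG : FinSmooth O G) (h0 : ∀ p ∈ O, G p ≠ 0) :
    FinSmooth O (fun p => F p / G p) := by
  filter_upwards [hF, hG] with S h1 h2
  exact ⟨h1.1.div h2.1 fun e he => h0 _ he,
    fun p hp => congrArg₂ (· / ·) (h1.2 p hp) (h2.2 p hp)⟩

theorem comp {h : ℝ → ℝ} {A : Set ℝ} (hh : ContDiffOn ℝ (⊤ : ℕ∞) h A) (hF : FinSmooth O F)
    (hm : ∀ p ∈ O, F p ∈ A) : FinSmooth O (fun p => h (F p)) := by
  filter_upwards [hF] with S h1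
  exact ⟨hh.comp h1.1 fun e he => hm _ he, fun p hp => congrArg h (h1.2 p hp)⟩

theorem mono {O' : Set (ℝ × JetB)} (hF : FinSmooth O F) (h : O' ⊆ O) : FinSmooth O' F := by
  filter_upwards [hF] with S h1
  exact ⟨h1.1.mono fun e he => h he, fun p hp => h1.2 p (h hp)⟩

theorem continuousOn (hF : FinSmooth O F) (hO : FinitaryOpen O) : ContinuousOn F O := by
  obtain ⟨S, h1, h2⟩ := (hF.and hO.eventually_mem).exists
  exact (h1.1.continuousOn.comp (continuous_restrictTo S).continuousOn h2).congr h1.2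

theorem finitaryOpen_preimage (hF : FinSmooth O F) (hO : FinitaryOpen O) {A : Set ℝ}
    (hA : IsOpen A) : FinitaryOpen (O ∩ F ⁻¹' A) := by
  refine ⟨(hF.continuousOn hO).isOpen_inter_preimage hO.isOpen hA, ?_⟩
  filter_upwards [hF, hO.eventually_mem] with S h1 h2 p hp
  exact ⟨h2 p hp.1, by simpa only [Set.mem_preimage, ← h1.2 p hp.1] using hp.2⟩

theorem admissibleTOn (hF : FinSmooth O F) (hO : FinitaryOpen O) {J : Set ℝ} {W : Set JetB}
    (h : ∀ t ∈ J, ∀ p ∈ W, (t, p) ∈ O) : AdmissibleTOn J W (fun t p => F (t, p)) := by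
  obtain ⟨S, h1, h2⟩ := (hF.and hO.eventually_mem).exists
  exact ⟨S, extendZero S ⁻¹' O, fun e => F (extendZero S e),
    hO.isOpen.preimage (continuous_extendZero S), h1.1,
    fun t ht p hp => ⟨h2 _ (h t ht p hp), h1.2 _ (h t ht p hp)⟩⟩

end FinSmooth

/-- A curve in `ℝ × J^∞(ℝ,ℝ²)` with componentwise derivative `v` at `τ`. -/
def HasVelocityAt (c : ℝ → ℝ × JetB) (v : ℝ × JetB) (τ : ℝ) : Prop :=
  HasDerivAt (fun s => (c s).1) v.1 τ ∧ HasDerivAt (fun s => (c s).2.1) v.2.1 τ ∧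
    ∀ q, HasDerivAt (fun s => (c s).2.2 q) (v.2.2 q) τ

namespace HasVelocityAt

variable {c : ℝ → ℝ × JetB} {v : ℝ × JetB} {τ : ℝ}

theorem continuousAt (h : HasVelocityAt c v τ) : ContinuousAt c τ :=
  h.1.continuousAt.prodMk (h.2.1.continuousAt.prodMk
    (continuousAt_pi.2 fun q => (h.2.2 q).continuousAt))

theorem restrictTo (h : HasVelocityAt c v τ) (S : Finset (Fin 2 × ℕ)) :
    HasDerivAt (fun s => restrictTo S (c s)) (restrictTo S v) τ :=
  h.1.prodMk (h.2.1.prodMk (hasDerivAt_pi.2 fun a => h.2.2 a.1))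

/-- Chain rule for a function of finitely many coordinates along a curve. -/
theorem hasDerivAt_comp (h : HasVelocityAt c v τ) {O : Set (ℝ × JetB)} {F : ℝ × JetB → ℝ}
    (hO : FinitaryOpen O) {S : Finset (Fin 2 × ℕ)}
    (hF : ContDiffOn ℝ (⊤ : ℕ∞) (fun e => F (extendZero S e)) (extendZero S ⁻¹' O) ∧
      ∀ p ∈ O, F p = F (extendZero S (_root_.restrictTo S p)))
    (hS : ∀ p ∈ O, extendZero S (_root_.restrictTo S p) ∈ O) (hc : c τ ∈ O) :
    HasDerivAt (fun s => F (c s))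
      (fderiv ℝ (fun e => F (extendZero S e)) (_root_.restrictTo S (c τ))
        (_root_.restrictTo S v)) τ := by
  have hd : DifferentiableAt ℝ (fun e => F (extendZero S e)) (_root_.restrictTo S (c τ)) :=
    (hF.1.contDiffAt ((hO.isOpen.preimage (continuous_extendZero S)).mem_nhds
      (hS _ hc))).differentiableAt (by simp)
  refine (hd.hasFDerivAt.comp_hasDerivAt τ (h.restrictTo S)).congr_of_eventuallyEq ?_
  filter_upwards [h.continuousAt.preimage_mem_nhds (hO.isOpen.mem_nhds hc)] with s hs
  exact hF.2 _ hs

end HasVelocityAt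

/-- The velocity, at a point, of the total derivative `D`. -/
def totalVec (p : JetB) : JetB := (1, fun q => p.2 (q.1, q.2 + 1))

/-- The line through `p` in the direction of the total derivative. -/
def totalLine (p : JetB) (a : ℝ) : JetB := (p.1 + a, fun q => p.2 q + a * p.2 (q.1, q.2 + 1))

@[simp]
theorem totalLine_zero (p : JetB) : totalLine p 0 = p := by simp [totalLine]

theorem hasDerivAt_totalLine_fst (p : JetB) : HasDerivAt (fun a => (totalLine p a).1) 1 0 :=
  (hasDerivAt_id (0 : ℝ)).const_add p.1

theorem hasDerivAt_totalLine_snd (p : JetB) (q : Fin 2 × ℕ) :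
    HasDerivAt (fun a => (totalLine p a).2 q) ((totalLine p 0).2 (q.1, q.2 + 1)) 0 := by
  simpa [totalLine] using ((hasDerivAt_id (0 : ℝ)).mul_const (p.2 (q.1, q.2 + 1))).const_add (p.2 q)

theorem totD_congr {F G : JetB → ℝ} {p : JetB} (h : F =ᶠ[𝓝 p] G) : totD F p = totD G p := by
  have hX : pdX F p = pdX G p := by
    refine EventuallyEq.deriv_eq ?_
    have hc : ContinuousAt (fun t : ℝ => ((t, p.2) : JetB)) p.1 := by fun_prop
    exact hc.eventually h
  have hY : ∀ q, pdY q F p = pdY q G p := fun q => by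
    refine EventuallyEq.deriv_eq ?_
    have hc : Tendsto (fun t : ℝ => ((p.1, Function.update p.2 q t) : JetB)) (𝓝 (p.2 q))
        (𝓝 p) := by
      have : Continuous (fun t : ℝ => ((p.1, Function.update p.2 q t) : JetB)) :=
        continuous_const.prodMk (continuous_const.update q continuous_id)
      simpa using this.tendsto (p.2 q)
    exact hc.eventually h
  simp only [totD, hX, hY]

theorem totD_eq_fderiv {O : Set (ℝ × JetB)} {F : ℝ × JetB → ℝ} (hO : FinitaryOpen O)
    {S : Finset (Fin 2 × ℕ)}
    (hF : ContDiffOn ℝ (⊤ : ℕ∞) (fun e => F (extendZero S e)) (extendZero S ⁻¹' O) ∧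
      ∀ p ∈ O, F p = F (extendZero S (restrictTo S p)))
    (hS : ∀ p ∈ O, extendZero S (restrictTo S p) ∈ O) {t : ℝ} {p : JetB} (hp : (t, p) ∈ O) :
    totD (fun q => F (t, q)) p =
      fderiv ℝ (fun e => F (extendZero S e)) (restrictTo S (t, p))
        (restrictTo S (0, totalVec p)) := by
  classical
  set A := fderiv ℝ (fun e => F (extendZero S e)) (restrictTo S (t, p)) with hA
  have hX : pdX (fun q => F (t, q)) p = A (restrictTo S (0, 1, 0)) := by
    have hv : HasVelocityAt (fun s => (t, s, p.2)) (0, 1, 0) p.1 :=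
      ⟨hasDerivAt_const _ _, hasDerivAt_id _, fun q => hasDerivAt_const _ _⟩
    exact (hv.hasDerivAt_comp hO hF hS hp).deriv
  have hY : ∀ q, pdY q (fun q => F (t, q)) p = A (restrictTo S (0, 0, Pi.single q 1)) := by
    intro q
    have hv : HasVelocityAt (fun s => (t, p.1, Function.update p.2 q s))
        (0, 0, Pi.single q 1) (p.2 q) :=
      ⟨hasDerivAt_const _ _, hasDerivAt_const _ _,
        hasDerivAt_pi.1 (hasDerivAt_update p.2 q (p.2 q))⟩
    have := (hv.hasDerivAt_comp hO hF hS (by simpa using hp)).deriv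
    simpa [pdY, hA] using this
  have hzero : ∀ q ∉ S, restrictTo S (0, 0, Pi.single q 1) = 0 := fun q hq => by
    refine Prod.ext rfl (Prod.ext rfl (funext fun a => ?_))
    have : a.1 ≠ q := fun h => hq (h ▸ a.2)
    simp [restrictTo, this]
  have hsum : restrictTo S (0, totalVec p) = restrictTo S (0, 1, 0) +
      ∑ q ∈ S, p.2 (q.1, q.2 + 1) • restrictTo S (0, 0, Pi.single q 1) := by
    refine Prod.ext ?_ (Prod.ext ?_ (funext fun a => ?_))
    · simp [restrictTo, Prod.fst_sum]
    · simp [restrictTo, totalVec, Prod.fst_sum, Prod.snd_sum]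
    · simp [restrictTo, totalVec, Prod.snd_sum, Finset.sum_apply, Pi.single_apply]
  rw [totD, hX, finsum_eq_sum_of_support_subset (s := S), hsum, map_add, map_sum]
  · simp [hY]
  · intro q hq
    by_contra hqS
    exact hq (by simp [hY, hzero q (by simpa using hqS)])

namespace FinSmooth

variable {O : Set (ℝ × JetB)} {F : ℝ × JetB → ℝ}

/-- Derivative along a curve tangent to the direction of the total derivative. -/
theorem hasDerivAt_totD (hF : FinSmooth O F) (hO : FinitaryOpen O) {t r τ : ℝ} {c : ℝ → JetB}
    (hp : (t, c τ) ∈ O) (hx : HasDerivAt (fun s => (c s).1) r τ)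
    (hy : ∀ q, HasDerivAt (fun s => (c s).2 q) (r * (c τ).2 (q.1, q.2 + 1)) τ) :
    HasDerivAt (fun s => F (t, c s)) (r * totD (fun q => F (t, q)) (c τ)) τ := by
  obtain ⟨S, h1, h2⟩ := (hF.and hO.eventually_mem).exists
  have hv : HasVelocityAt (fun s => (t, c s)) (r • (0, totalVec (c τ))) τ :=
    ⟨by simpa using hasDerivAt_const τ t, by simpa [totalVec] using hx,
      by simpa [totalVec] using hy⟩
  have h := hv.hasDerivAt_comp hO h1 h2 hp
  rw [totD_eq_fderiv hO h1 h2 hp, ← smul_eq_mul, ← map_smul]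
  exact h

theorem hasDerivAt_totalLine (hF : FinSmooth O F) (hO : FinitaryOpen O) {t : ℝ} {p : JetB}
    (hp : (t, p) ∈ O) :
    HasDerivAt (fun a => F (t, totalLine p a)) (_root_.totD (fun q => F (t, q)) p) 0 := by
  have h := hF.hasDerivAt_totD hO (r := 1) (c := totalLine p) (by rwa [totalLine_zero])
    (hasDerivAt_totalLine_fst p) (by simpa using hasDerivAt_totalLine_snd p)
  simpa using h

theorem totD (hF : FinSmooth O F) (hO : FinitaryOpen O) :
    FinSmooth O (fun p => totD (fun q => F (p.1, q)) p.2) := by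
  classical
  obtain ⟨S, h1, h2⟩ := (hF.and hO.eventually_mem).exists
  filter_upwards [hO.eventually_mem, eventually_ge_atTop S,
    eventually_ge_atTop (S.image fun q => (q.1, q.2 + 1))] with S' h3 hSS hSS'
  have hU : IsOpen (extendZero S ⁻¹' O) := hO.isOpen.preimage (continuous_extendZero S)
  have hD : ContDiffOn ℝ (⊤ : ℕ∞) (fderiv ℝ (fun e => F (extendZero S e)))
      (extendZero S ⁻¹' O) := h1.1.fderiv_of_isOpen hU (by simp)
  refine ⟨?_, fun p hp => ?_⟩
  · have hr : ContDiff ℝ (⊤ : ℕ∞) (fun e => restrictTo S (extendZero S' e)) :=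
      contDiff_fst.prodMk (contDiff_snd.fst.prodMk
        (contDiff_pi.2 fun a => contDiff_extendZero_apply S' a.1))
    have hv : ContDiff ℝ (⊤ : ℕ∞)
        (fun e => restrictTo S (0, totalVec (extendZero S' e).2)) :=
      contDiff_const.prodMk (contDiff_const.prodMk
        (contDiff_pi.2 fun a => contDiff_extendZero_apply S' (a.1.1, a.1.2 + 1)))
    refine ((hD.comp hr.contDiffOn fun e he => h2 _ he).clm_apply hv.contDiffOn).congr ?_
    intro e he
    exact totD_eq_fderiv hO h1 h2 he
  · have hp' := h3 p hp
    have hv : restrictTo S (0, totalVec (extendZero S' (restrictTo S' p)).2) =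
        restrictTo S (0, totalVec p.2) := by
      refine Prod.ext rfl (Prod.ext rfl (funext fun a => ?_))
      have ha : (a.1.1, a.1.2 + 1) ∈ S' := hSS' (Finset.mem_image_of_mem _ a.2)
      simp [restrictTo, totalVec, extendZero, ha]
    have e1 := totD_eq_fderiv (t := p.1) (p := p.2) hO h1 h2 hp
    have e2 := totD_eq_fderiv (t := (extendZero S' (restrictTo S' p)).1)
      (p := (extendZero S' (restrictTo S' p)).2) hO h1 h2 hp'
    rw [e1, e2, hv]
    exact congrArg (fun e => fderiv ℝ (fun e => F (extendZero S e)) e _)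
      (restrictTo_extendZero_restrictTo hSS p).symm

/-- Time derivatives commute with the total derivative. -/
theorem hasDerivAt_time_totD (hF : FinSmooth O F) (hO : FinitaryOpen O) {t : ℝ} {p : JetB}
    (hp : (t, p) ∈ O) {E : JetB → ℝ}
    (hE : ∀ᶠ q in 𝓝 p, HasDerivAt (fun s => F (s, q)) (E q) t) :
    HasDerivAt (fun s => _root_.totD (fun q => F (s, q)) p) (_root_.totD E p) t := by
  obtain ⟨S, h1, h2⟩ := (hF.and hO.eventually_mem).exists
  have hU : IsOpen (extendZero S ⁻¹' O) := hO.isOpen.preimage (continuous_extendZero S)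
  have hG := h1.1.contDiffAt (hU.mem_nhds (h2 _ hp))
  have hD : ContDiffOn ℝ (⊤ : ℕ∞) (fderiv ℝ (fun e => F (extendZero S e)))
      (extendZero S ⁻¹' O) := h1.1.fderiv_of_isOpen hU (by simp)
  have hA := ((hD.contDiffAt (hU.mem_nhds (h2 _ hp))).differentiableAt (by simp)).hasFDerivAt
  set A := fderiv ℝ (fun e => F (extendZero S e)) with hAdef
  have hsymm : IsSymmSndFDerivAt ℝ (fun e => F (extendZero S e)) (restrictTo S (t, p)) :=
    hG.isSymmSndFDerivAt
      (by rw [minSmoothness_of_isRCLikeNormedField]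
          exact WithTop.coe_le_coe.2 (le_top : (2 : ℕ∞) ≤ ⊤))
  have hvel : ∀ q : JetB, HasVelocityAt (fun s => (s, q)) (1, 0) t := fun q =>
    ⟨hasDerivAt_id _, hasDerivAt_const _ q.1, fun r => hasDerivAt_const _ (q.2 r)⟩
  have hleft : ∀ e : ℝ × ℝ × (↥S → ℝ), restrictTo S (extendZero S e) = e := fun e => by
    refine Prod.ext rfl (Prod.ext rfl (funext fun a => ?_))
    simp [restrictTo, extendZero]
  have hEq : E =ᶠ[𝓝 p] fun q => A (restrictTo S (t, q)) (restrictTo S (1, 0)) := by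
    have hc : ContinuousAt (fun q : JetB => (t, q)) p := by fun_prop
    filter_upwards [hE, hc.preimage_mem_nhds (hO.isOpen.mem_nhds hp)] with q hq hqO
    exact hq.unique ((hvel q).hasDerivAt_comp hO h1 h2 hqO)
  have hT : _root_.totD E p =
      fderiv ℝ A (restrictTo S (t, p)) (restrictTo S (0, totalVec p)) (restrictTo S (1, 0)) := by
    have hE' : ContDiffOn ℝ (⊤ : ℕ∞) (fun e =>
        A (restrictTo S (extendZero S e)) (restrictTo S (1, 0))) (extendZero S ⁻¹' O) ∧
        ∀ p ∈ O, A (restrictTo S p) (restrictTo S (1, 0)) =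
          A (restrictTo S (extendZero S (restrictTo S p))) (restrictTo S (1, 0)) := by
      simp only [hleft, implies_true, and_true]
      exact hD.clm_apply contDiffOn_const
    rw [totD_congr hEq, totD_eq_fderiv (F := fun p => A (restrictTo S p) (restrictTo S (1, 0)))
      hO hE' h2 hp]
    simp only [hleft]
    rw [(hA.clm_apply (hasFDerivAt_const _ _)).fderiv]
    simp
  rw [hT, hsymm.eq]
  have hAt : HasDerivAt (fun s => A (restrictTo S (s, p)))
      (fderiv ℝ A (restrictTo S (t, p)) (restrictTo S (1, 0))) t :=
    hA.comp_hasDerivAt t ((hvel p).restrictTo S)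
  have hAv : HasDerivAt (fun s => A (restrictTo S (s, p)) (restrictTo S (0, totalVec p)))
      (fderiv ℝ A (restrictTo S (t, p)) (restrictTo S (1, 0)) (restrictTo S (0, totalVec p))) t := by
    simpa using hAt.clm_apply (hasDerivAt_const t (restrictTo S (0, totalVec p)))
  refine hAv.congr_of_eventuallyEq ?_
  have hc : ContinuousAt (fun s : ℝ => (s, p)) t := by fun_prop
  filter_upwards [hc.preimage_mem_nhds (hO.isOpen.mem_nhds hp)] with s hs
  exact totD_eq_fderiv hO h1 h2 hs

end FinSmooth

/-- The components `H^k_L` of the prolongation of the straight-line motion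
`x + t ξ`, `y^0_L + t η^0_L`. -/
noncomputable def prolongedLine (ξ : JetB → ℝ) (η0 : Fin 2 → JetB → ℝ) (L : Fin 2) :
    ℕ → ℝ × JetB → ℝ
  | 0 => fun p => p.2.2 (L, 0) + p.1 * η0 L p.2
  | (k + 1) => fun p =>
      totD (fun q => prolongedLine ξ η0 L k (p.1, q)) p.2 / (1 + p.1 * totD ξ p.2)

/-- The prolonged straight-line motion with velocity `ξ, η^0_L`. -/
noncomputable def lineFlow (ξ : JetB → ℝ) (η0 : Fin 2 → JetB → ℝ) (t : ℝ) (p : JetB) : JetB :=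
  (p.1 + t * ξ p, fun q => prolongedLine ξ η0 q.1 q.2 (t, p))

/-- The set of times and jets, with base in `V`, where the prolongation is defined. -/
def lineDomain (ξ : JetB → ℝ) (V : Set JetB) : Set (ℝ × JetB) :=
  (Set.univ ×ˢ V) ∩ (fun p => 1 + p.1 * totD ξ p.2) ⁻¹' {0}ᶜ

section LineFlow

variable {ξ : JetB → ℝ} {η0 : Fin 2 → JetB → ℝ} {V : Set JetB}

theorem finitaryOpen_lineDomain (hV : FinitaryOpen (Set.univ ×ˢ V))
    (hξ : FinSmooth (Set.univ ×ˢ V) (fun p => ξ p.2)) : FinitaryOpen (lineDomain ξ V) :=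
  ((finSmooth_const _ 1).add ((finSmooth_time _).mul (hξ.totD hV))).finitaryOpen_preimage hV
    isOpen_compl_singleton

theorem finSmooth_prolongedLine (hV : FinitaryOpen (Set.univ ×ˢ V))
    (hξ : FinSmooth (Set.univ ×ˢ V) (fun p => ξ p.2))
    (hη : ∀ L, FinSmooth (Set.univ ×ˢ V) (fun p => η0 L p.2)) (L : Fin 2) (k : ℕ) :
    FinSmooth (lineDomain ξ V) (prolongedLine ξ η0 L k) := by
  have hsub : lineDomain ξ V ⊆ Set.univ ×ˢ V := Set.inter_subset_left
  induction k with
  | zero => exact (finSmooth_coord _ _).add ((finSmooth_time _).mul ((hη L).mono hsub))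
  | succ k ih =>
    exact (ih.totD (finitaryOpen_lineDomain hV hξ)).div
      ((finSmooth_const _ 1).add ((finSmooth_time _).mul ((hξ.totD hV).mono hsub)))
      fun p hp => hp.2

theorem zero_mem_lineDomain {p : JetB} (hp : p ∈ V) : ((0 : ℝ), p) ∈ lineDomain ξ V := by
  simp [lineDomain, hp]

theorem totD_coord (q : Fin 2 × ℕ) (p : JetB) :
    totD (fun r => r.2 q) p = p.2 (q.1, q.2 + 1) := by
  have h := (finSmooth_coord Set.univ q).hasDerivAt_totalLine finitaryOpen_univ (t := 0)
    (p := p) trivial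
  simpa using h.unique (hasDerivAt_totalLine_snd p q)

theorem isOpen_of_finitaryOpen (hV : FinitaryOpen (Set.univ ×ˢ V)) : IsOpen V := by
  have : Continuous (fun p : JetB => ((0 : ℝ), p)) := by fun_prop
  simpa using hV.isOpen.preimage this

theorem prolongedLine_zero (hV : IsOpen V) (L : Fin 2) (k : ℕ) :
    ∀ p ∈ V, prolongedLine ξ η0 L k (0, p) = p.2 (L, k) := by
  induction k with
  | zero => intro p _; simp [prolongedLine]
  | succ k ih =>
    intro p hp
    have : (fun q => prolongedLine ξ η0 L k (0, q)) =ᶠ[𝓝 p] fun q => q.2 (L, k) := by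
      filter_upwards [hV.mem_nhds hp] with q hq using ih q hq
    simp [prolongedLine, totD_congr this, totD_coord]

theorem hasDerivAt_prolongedLine (hV : FinitaryOpen (Set.univ ×ˢ V))
    (hξ : FinSmooth (Set.univ ×ˢ V) (fun p => ξ p.2))
    (hη : ∀ L, FinSmooth (Set.univ ×ˢ V) (fun p => η0 L p.2)) (L : Fin 2) (k : ℕ) :
    ∀ p ∈ V, HasDerivAt (fun t => prolongedLine ξ η0 L k (t, p)) (etaLB ξ η0 L k p) 0 := by
  induction k with
  | zero =>
    intro p _
    simpa [prolongedLine, etaLB] using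
      ((hasDerivAt_id (0 : ℝ)).mul_const (η0 L p)).const_add (p.2 (L, 0))
  | succ k ih =>
    intro p hp
    have hVo := isOpen_of_finitaryOpen hV
    have hnum := (finSmooth_prolongedLine hV hξ hη L k).hasDerivAt_time_totD
      (finitaryOpen_lineDomain hV hξ) (zero_mem_lineDomain hp)
      (E := etaLB ξ η0 L k) (by filter_upwards [hVo.mem_nhds hp] with q hq using ih q hq)
    have hden := ((hasDerivAt_id (0 : ℝ)).mul_const (totD ξ p)).const_add 1
    have h0 := prolongedLine_zero (ξ := ξ) (η0 := η0) hVo L (k + 1) p hp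
    simp only [prolongedLine, zero_mul, add_zero, div_one] at h0
    have := hnum.div hden (by simp)
    refine this.congr_deriv ?_
    simp [h0, etaLB]

/-- The jet motion along the direction of the total derivative is carried by the flow to a curve
tangent to that direction. -/
theorem hasDerivAt_lineFlow_comp (hV : FinitaryOpen (Set.univ ×ˢ V))
    (hξ : FinSmooth (Set.univ ×ˢ V) (fun p => ξ p.2))
    (hη : ∀ L, FinSmooth (Set.univ ×ˢ V) (fun p => η0 L p.2)) {s : ℝ} {c : ℝ → JetB} {τ : ℝ}
    (hp : (s, c τ) ∈ lineDomain ξ V) (hx : HasDerivAt (fun a => (c a).1) 1 τ)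
    (hy : ∀ q, HasDerivAt (fun a => (c a).2 q) ((c τ).2 (q.1, q.2 + 1)) τ) :
    HasDerivAt (fun a => (lineFlow ξ η0 s (c a)).1) (1 + s * totD ξ (c τ)) τ ∧
    ∀ q, HasDerivAt (fun a => (lineFlow ξ η0 s (c a)).2 q)
      ((1 + s * totD ξ (c τ)) * (lineFlow ξ η0 s (c τ)).2 (q.1, q.2 + 1)) τ := by
  have hy' : ∀ q, HasDerivAt (fun a => (c a).2 q) (1 * (c τ).2 (q.1, q.2 + 1)) τ := by
    simpa using hy
  refine ⟨?_, fun q => ?_⟩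
  · have := hξ.hasDerivAt_totD hV (t := s) hp.1 hx hy'
    rw [one_mul] at this
    exact hx.add (this.const_mul s)
  · have := (finSmooth_prolongedLine hV hξ hη q.1 q.2).hasDerivAt_totD
      (finitaryOpen_lineDomain hV hξ) hp hx hy'
    refine this.congr_deriv ?_
    have h0 : 1 + s * totD ξ (c τ) ≠ 0 := hp.2
    simp only [lineFlow, prolongedLine]
    field_simp

/-- The group law for the prolongation of a straight-line motion whose velocity is invariant. -/
theorem lineFlow_lineFlow (hV : FinitaryOpen (Set.univ ×ˢ V))
    (hξ : FinSmooth (Set.univ ×ˢ V) (fun p => ξ p.2))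
    (hη : ∀ L, FinSmooth (Set.univ ×ˢ V) (fun p => η0 L p.2)) {s t : ℝ} {W : Set JetB}
    (hW : IsOpen W) (hs : ∀ p ∈ W, (s, p) ∈ lineDomain ξ V)
    (ht : ∀ p ∈ W, (t, p) ∈ lineDomain ξ V) (hts : ∀ p ∈ W, (t + s, p) ∈ lineDomain ξ V)
    (hinv : ∀ p ∈ W, lineFlow ξ η0 s p ∈ W → ξ (lineFlow ξ η0 s p) = ξ p ∧
      ∀ L, η0 L (lineFlow ξ η0 s p) = η0 L p) :
    ∀ p ∈ W, lineFlow ξ η0 s p ∈ W →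
      lineFlow ξ η0 t (lineFlow ξ η0 s p) = lineFlow ξ η0 (t + s) p := by
  have key : ∀ (L : Fin 2) (k : ℕ), ∀ p ∈ W, lineFlow ξ η0 s p ∈ W →
      prolongedLine ξ η0 L k (t, lineFlow ξ η0 s p) = prolongedLine ξ η0 L k (t + s, p) := by
    intro L k
    induction k with
    | zero =>
      intro p hp hp'
      simp only [prolongedLine, (hinv p hp hp').2 L]
      simp only [lineFlow, prolongedLine]
      ring
    | succ k ih =>
      intro p hp hp'
      obtain ⟨hfx, hfy⟩ := hasDerivAt_lineFlow_comp hV hξ hη (s := s) (c := totalLine p)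
        (τ := 0) (by simpa using hs p hp) (hasDerivAt_totalLine_fst p)
        (hasDerivAt_totalLine_snd p)
      have hcc : ContinuousAt (totalLine p) 0 := (hasDerivAt_totalLine_fst p).continuousAt.prodMk
        (continuousAt_pi.2 fun q => (hasDerivAt_totalLine_snd p q).continuousAt)
      have hfc : ContinuousAt (fun a => lineFlow ξ η0 s (totalLine p a)) 0 :=
        hfx.continuousAt.prodMk (continuousAt_pi.2 fun q => (hfy q).continuousAt)
      have hev : ∀ᶠ a in 𝓝 (0 : ℝ), totalLine p a ∈ W ∧ lineFlow ξ η0 s (totalLine p a) ∈ W :=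
        (hcc.eventually (hW.mem_nhds (by simpa using hp))).and
          (hfc.eventually (hW.mem_nhds (by simpa using hp')))
      have hH := finSmooth_prolongedLine hV hξ hη L k
      have hO := finitaryOpen_lineDomain hV hξ
      have e1 := hH.hasDerivAt_totD hO (t := t) (c := fun a => lineFlow ξ η0 s (totalLine p a))
        (by simpa using ht _ hp') hfx hfy
      have e1' : HasDerivAt (fun a => prolongedLine ξ η0 L k (t + s, totalLine p a)) _ 0 :=
        e1.congr_of_eventuallyEq
          (by filter_upwards [hev] with a ha using (ih _ ha.1 ha.2).symm)
      have e3 := hξ.hasDerivAt_totD hV (t := t)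
        (c := fun a => lineFlow ξ η0 s (totalLine p a)) (by simpa using (ht _ hp').1) hfx hfy
      have e3' : HasDerivAt (fun a => ξ (totalLine p a)) _ 0 :=
        e3.congr_of_eventuallyEq
          (by filter_upwards [hev] with a ha using (hinv _ ha.1 ha.2).1.symm)
      have u1 := e1'.unique (hH.hasDerivAt_totalLine hO (hts p hp))
      have u2 := e3'.unique (hξ.hasDerivAt_totalLine hV (ht p hp).1)
      simp only [totalLine_zero] at u1 u2
      have n1 : 1 + s * totD ξ p ≠ 0 := (hs p hp).2
      have n2 : 1 + t * totD ξ (lineFlow ξ η0 s p) ≠ 0 := (ht _ hp').2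
      have n3 : 1 + (t + s) * totD ξ p ≠ 0 := (hts p hp).2
      have hden : (1 + s * totD ξ p) * (1 + t * totD ξ (lineFlow ξ η0 s p)) =
          1 + (t + s) * totD ξ p := by linear_combination t * u2
      simp only [prolongedLine]
      rw [← u1, ← hden, mul_div_mul_left _ _ n1]
  intro p hp hp'
  refine Prod.ext ?_ (funext fun q => key q.1 q.2 p hp hp')
  have h := (hinv p hp hp').1
  change (lineFlow ξ η0 s p).1 + t * ξ (lineFlow ξ η0 s p) = p.1 + (t + s) * ξ p
  rw [h]
  simp only [lineFlow]
  ring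

end LineFlow

/-- on the region where `y^1_1 ≠ 0` and `z = y^1_2/y^1_1 ∈ I`, the
Lie–Bäcklund field with principal components `ξ = g(z)`, `η^0_1 = F₁′(z)`,
`η^0_2 = z F₁′(z) − F₁(z)` is exponentiable to a local flow with
`Ξ_t = x + t ξ` and `H^0_{L,t} = y^0_L + t η^0_L`. -/
theorem radial_example (I : Set ℝ) (hI : IsOpen I) (hIconn : I.OrdConnected)
    (F₁ g : ℝ → ℝ) (hF₁ : ContDiffOn ℝ (⊤ : ℕ∞) F₁ I) (hg : ContDiffOn ℝ (⊤ : ℕ∞) g I)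
    (ξ : JetB → ℝ) (η0 : Fin 2 → JetB → ℝ)
    (hξ : ∀ p : JetB, ξ p = g (p.2 (1, 1) / p.2 (0, 1)))
    (hη01 : ∀ p : JetB, η0 0 p = deriv F₁ (p.2 (1, 1) / p.2 (0, 1)))
    (hη02 : ∀ p : JetB, η0 1 p =
      (p.2 (1, 1) / p.2 (0, 1)) * deriv F₁ (p.2 (1, 1) / p.2 (0, 1)) -
        F₁ (p.2 (1, 1) / p.2 (0, 1))) :
    ∀ P : JetB, P.2 (0, 1) ≠ 0 → P.2 (1, 1) / P.2 (0, 1) ∈ I →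
      ∃ W : Set JetB, IsOpen W ∧ P ∈ W ∧
        (∀ p ∈ W, p.2 (0, 1) ≠ 0 ∧ p.2 (1, 1) / p.2 (0, 1) ∈ I) ∧
        ∃ δ : ℝ, 0 < δ ∧ ∃ Φ : ℝ → JetB → JetB,
          IsLocalFlowOf ξ η0 W δ Φ ∧
          (∀ t ∈ Set.Ioo (-δ) δ, ∀ p ∈ W,
            (Φ t p).1 = p.1 + t * ξ p ∧
            ∀ L : Fin 2, (Φ t p).2 (L, 0) = p.2 (L, 0) + t * η0 L p) := by
  set z : JetB → ℝ := fun p => p.2 (1, 1) / p.2 (0, 1) with hz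
  set V : Set JetB := {p | p.2 (0, 1) ≠ 0 ∧ z p ∈ I}
  have hV1 : FinitaryOpen (Set.univ ∩ (fun p : ℝ × JetB => p.2.2 (0, 1)) ⁻¹' {0}ᶜ) :=
    (finSmooth_coord Set.univ (0, 1)).finitaryOpen_preimage finitaryOpen_univ
      isOpen_compl_singleton
  have hz1 := (finSmooth_coord (Set.univ ∩ (fun p : ℝ × JetB => p.2.2 (0, 1)) ⁻¹' {0}ᶜ)
    (1, 1)).div (finSmooth_coord _ (0, 1)) fun p hp => hp.2
  have hVeq : Set.univ ×ˢ V = (Set.univ ∩ (fun p : ℝ × JetB => p.2.2 (0, 1)) ⁻¹' {0}ᶜ) ∩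
      (fun p : ℝ × JetB => p.2.2 (1, 1) / p.2.2 (0, 1)) ⁻¹' I := by
    ext p; simp [V, z]
  have hV : FinitaryOpen (Set.univ ×ˢ V) := hVeq ▸ hz1.finitaryOpen_preimage hV1 hI
  have hzV : FinSmooth (Set.univ ×ˢ V) (fun p => z p.2) :=
    hz1.mono (hVeq ▸ Set.inter_subset_left)
  have hzI : ∀ p ∈ (Set.univ ×ˢ V : Set (ℝ × JetB)), z p.2 ∈ I := fun p hp => hp.2.2
  have hF' : ContDiffOn ℝ (⊤ : ℕ∞) (deriv F₁) I := hF₁.deriv_of_isOpen hI (by simp)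
  have hξz : ξ = fun p => g (z p) := funext hξ
  have hη0z : η0 0 = fun p => deriv F₁ (z p) := funext hη01
  have hη1z : η0 1 = fun p => z p * deriv F₁ (z p) - F₁ (z p) := funext hη02
  have hξS : FinSmooth (Set.univ ×ˢ V) (fun p => ξ p.2) := by
    rw [hξz]; exact FinSmooth.comp hg hzV hzI
  have hη0S : FinSmooth (Set.univ ×ˢ V) (fun p => η0 0 p.2) := by
    rw [hη0z]; exact FinSmooth.comp hF' hzV hzI
  have hη1S : FinSmooth (Set.univ ×ˢ V) (fun p => η0 1 p.2) := by
    rw [hη1z]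
    exact (hzV.mul (FinSmooth.comp hF' hzV hzI)).sub (FinSmooth.comp hF₁ hzV hzI)
  have hηS : ∀ L, FinSmooth (Set.univ ×ˢ V) (fun p => η0 L p.2) :=
    Fin.forall_fin_two.2 ⟨hη0S, hη1S⟩
  have hDη : ∀ p ∈ V, totD (η0 1) p = z p * totD (η0 0) p := by
    intro p hp
    have hm : ((0 : ℝ), p) ∈ Set.univ ×ˢ V := ⟨trivial, hp⟩
    have d0 := hη0S.hasDerivAt_totalLine hV hm
    have d1 := hη1S.hasDerivAt_totalLine hV hm
    have dz := hzV.hasDerivAt_totalLine hV hm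
    have hF : HasDerivAt F₁ (deriv F₁ (z p)) (z p) :=
      ((hF₁.contDiffAt (hI.mem_nhds hm.2.2)).differentiableAt (by simp)).hasDerivAt
    simp only [hη1z] at d1
    have d1' := (dz.mul d0).sub (hF.comp_of_eq 0 dz (by simp))
    simp only [hη0z] at d1' d0
    have := d1.unique d1'
    simp only [hη0z, hη1z, totalLine_zero] at this ⊢
    linear_combination this
  have hinv : ∀ s p, (s, p) ∈ lineDomain ξ V → lineFlow ξ η0 s p ∈ V →
      z (lineFlow ξ η0 s p) = z p := by
    intro s p hp hp'
    have hpV : p ∈ V := hp.1.2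
    have h0 : 1 + s * totD ξ p ≠ 0 := hp.2
    have hT : ∀ L, (1 + s * totD ξ p) * (lineFlow ξ η0 s p).2 (L, 1) =
        p.2 (L, 1) + s * totD (η0 L) p := by
      intro L
      have hm : (s, p) ∈ Set.univ ×ˢ V := hp.1
      have h1 := (finSmooth_prolongedLine hV hξS hηS L 0).hasDerivAt_totalLine
        (finitaryOpen_lineDomain hV hξS) hp
      have h2 := (hasDerivAt_totalLine_snd p (L, 0)).add
        (((hηS L).hasDerivAt_totalLine hV hm).const_mul s)
      have h3 := h1.unique h2
      simp only [totalLine_zero] at h3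
      rw [← h3]
      exact mul_div_cancel₀ _ h0
    have hy : p.2 (1, 1) = z p * p.2 (0, 1) := (div_mul_cancel₀ _ hpV.1).symm
    have hne : (lineFlow ξ η0 s p).2 (0, 1) ≠ 0 := hp'.1
    have h10 := hT 1
    rw [hDη p hpV, hy] at h10
    rw [hz]
    change _ / _ = z p
    rw [div_eq_iff hne]
    refine mul_left_cancel₀ h0 ?_
    linear_combination h10 - z p * hT 0
  intro P hP0 hPI
  have hVo := isOpen_of_finitaryOpen hV
  have hPV : P ∈ V := ⟨hP0, hPI⟩
  have hDc : ContinuousOn (totD ξ) V := by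
    have hc : Continuous (fun p : JetB => ((0 : ℝ), p)) := by fun_prop
    exact ((hξS.totD hV).continuousOn hV).comp hc.continuousOn fun p hp => ⟨trivial, hp⟩
  set C := |totD ξ P| + 1 with hC
  have hCpos : 0 < C := by positivity
  set W : Set JetB := V ∩ totD ξ ⁻¹' Set.Ioo (-C) C
  have hW : IsOpen W := hDc.isOpen_inter_preimage hVo isOpen_Ioo
  have hWO : ∀ t ∈ Set.Ioo (-C⁻¹) C⁻¹, ∀ p ∈ W, (t, p) ∈ lineDomain ξ V := by
    intro t ht p hp
    refine ⟨⟨trivial, hp.1⟩, fun h => ?_⟩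
    have h1 : |t| < C⁻¹ := abs_lt.2 ht
    have h2 : |totD ξ p| < C := abs_lt.2 hp.2
    have h3 : |t| * |totD ξ p| < C⁻¹ * C := mul_lt_mul'' h1 h2 (abs_nonneg _) (abs_nonneg _)
    rw [inv_mul_cancel₀ hCpos.ne', ← abs_mul] at h3
    have h4 : 1 + t * totD ξ p = 0 := h
    linarith [neg_abs_le (t * totD ξ p)]
  have hO := finitaryOpen_lineDomain hV hξS
  refine ⟨W, hW, ⟨hPV, abs_lt.1 (lt_add_one _)⟩, fun p hp => hp.1, C⁻¹, inv_pos.2 hCpos,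
    lineFlow ξ η0, ⟨?_, ?_, ?_, ?_, ?_, ?_⟩, ?_⟩
  · exact ((finSmooth_base _).add ((finSmooth_time _).mul
      (hξS.mono Set.inter_subset_left))).admissibleTOn hO hWO
  · exact fun q => (finSmooth_prolongedLine hV hξS hηS q.1 q.2).admissibleTOn hO hWO
  · exact fun p hp => Prod.ext (by simp [lineFlow])
      (funext fun q => prolongedLine_zero hVo q.1 q.2 p hp.1)
  · intro s hs t ht hts
    refine lineFlow_lineFlow hV hξS hηS hW (hWO s hs) (hWO t ht) (hWO _ hts) fun p hp hp' => ?_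
    have h := hinv s p (hWO s hs p hp) hp'.1
    refine ⟨by rw [hξ, hξ]; exact congrArg g h, Fin.forall_fin_two.2 ⟨?_, ?_⟩⟩
    · rw [hη01, hη01]; exact congrArg (deriv F₁) h
    · rw [hη02, hη02]; exact congrArg (fun a => a * deriv F₁ a - F₁ a) h
  · intro p _
    simpa [lineFlow] using ((hasDerivAt_id (0 : ℝ)).mul_const (ξ p)).const_add p.1
  · exact fun L k p hp => hasDerivAt_prolongedLine hV hξS hηS L k p hp.1
  · exact fun t _ p _ => ⟨rfl, fun L => rfl⟩
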